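/- arXiv:0706.0287 — 4 statements merged into one kernel-verified Lean document; each statement's English description precedes it below -/
import Mathlib

section
/- For every h ∈ H one has S⁴(h) = α⁻¹(h₁)·a·h₂·a⁻¹·α(h₃), where α⁻¹ = α∘S; equivalently, S⁴ is the composition of conjugation by the modular grouplike a with the co-inner automorphism determined by α. -/
open TensorProduct Coalgebra HopfAlgebra

variable {k H : Type*} [Field k] [Ring H] [HopfAlgebra k H]

/-- The antipode of `H`, as a linear map. -/
local notation "𝐒" => HopfAlgebra.antipode (R := k)

/-- Convolution product on the dual of `H`: `(conv f g) h = f h₁ * g h₂`. -/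
noncomputable def conv (f g : H →ₗ[k] k) : H →ₗ[k] k :=
  (LinearMap.mul' k k) ∘ₗ (TensorProduct.map f g) ∘ₗ (Coalgebra.comul (R := k))

/-- `h ↦ f h₁ • h₂`. -/
noncomputable def lT (f : H →ₗ[k] k) : H →ₗ[k] H :=
  (TensorProduct.lid k H).toLinearMap ∘ₗ (f.rTensor H) ∘ₗ (Coalgebra.comul (R := k))

/-- The Sweedler sum `h ↦ f h₁ • p h₃ • g h₂`. -/
noncomputable def sw3 (f : H →ₗ[k] k) (g : H →ₗ[k] H) (p : H →ₗ[k] k) : H →ₗ[k] H :=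
  (TensorProduct.lid k H).toLinearMap
    ∘ₗ (TensorProduct.rid k (k ⊗[k] H)).toLinearMap
    ∘ₗ (TensorProduct.map (TensorProduct.map f g) p)
    ∘ₗ ((Coalgebra.comul (R := k)).rTensor H)
    ∘ₗ (Coalgebra.comul (R := k))

/-- `χ(h) = α(h₂) • S⁻²(h₁)`, the generalized Nakayama automorphism. -/
noncomputable def chiMap (Sinv : H →ₗ[k] H) (f : H →ₗ[k] k) : H →ₗ[k] H :=
  (TensorProduct.rid k H).toLinearMap
    ∘ₗ (TensorProduct.map (Sinv ∘ₗ Sinv) f)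
    ∘ₗ (Coalgebra.comul (R := k))

/-- `f(R¹) • R²` for `R = R¹ ⊗ R² ∈ H ⊗ H`. -/
noncomputable def lap (f : H →ₗ[k] k) : (H ⊗[k] H) →ₗ[k] H :=
  (TensorProduct.lid k H).toLinearMap ∘ₗ (f.rTensor H)

/-- `f(R²) • R¹` for `R = R¹ ⊗ R² ∈ H ⊗ H`. -/
noncomputable def rap (f : H →ₗ[k] k) : (H ⊗[k] H) →ₗ[k] H :=
  (TensorProduct.rid k H).toLinearMap ∘ₗ (LinearMap.lTensor H f)

/-- The Drinfeld element `u = S(R²)R¹`. -/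
noncomputable def uElt (Rm : H ⊗[k] H) : H :=
  (LinearMap.mul' k H)
    ((TensorProduct.comm k H H)
      ((LinearMap.lTensor H (HopfAlgebra.antipode (R := k))) Rm))

/-- Convolution product on the dual of `H ⊗ H`. -/
noncomputable def conv2 (f g : (H ⊗[k] H) →ₗ[k] k) : (H ⊗[k] H) →ₗ[k] k :=
  (LinearMap.mul' k k) ∘ₗ (TensorProduct.map f g) ∘ₗ (Coalgebra.comul (R := k) (A := H ⊗[k] H))

/-- `(h ⊗ l) ↦ σ(h₂ ⊗ l₂) • (l₁ * h₁)`. -/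
noncomputable def ac1 (σ : (H ⊗[k] H) →ₗ[k] k) : (H ⊗[k] H) →ₗ[k] H :=
  (TensorProduct.rid k H).toLinearMap
    ∘ₗ (TensorProduct.map ((LinearMap.mul' k H) ∘ₗ (TensorProduct.comm k H H).toLinearMap) σ)
    ∘ₗ (TensorProduct.tensorTensorTensorComm k H H H H).toLinearMap
    ∘ₗ (TensorProduct.map (Coalgebra.comul (R := k)) (Coalgebra.comul (R := k)))

/-- `(h ⊗ l) ↦ σ(h₁ ⊗ l₁) • (h₂ * l₂)`. -/
noncomputable def ac2 (σ : (H ⊗[k] H) →ₗ[k] k) : (H ⊗[k] H) →ₗ[k] H :=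
  (TensorProduct.lid k H).toLinearMap
    ∘ₗ (TensorProduct.map σ (LinearMap.mul' k H))
    ∘ₗ (TensorProduct.tensorTensorTensorComm k H H H H).toLinearMap
    ∘ₗ (TensorProduct.map (Coalgebra.comul (R := k)) (Coalgebra.comul (R := k)))

/-- `(h ⊗ l) ↦ ρ(h₁ ⊗ l₁) * lam(h₂ * l₂) * τ(h₃ ⊗ l₃)`. -/
noncomputable def trip (lam : H →ₗ[k] k) (ρ τ : (H ⊗[k] H) →ₗ[k] k) : (H ⊗[k] H) →ₗ[k] k :=
  (LinearMap.mul' k k)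
    ∘ₗ ((LinearMap.mul' k k).rTensor k)
    ∘ₗ (TensorProduct.map (TensorProduct.map ρ (lam ∘ₗ (LinearMap.mul' k H))) τ)
    ∘ₗ ((TensorProduct.tensorTensorTensorComm k H H H H).toLinearMap.rTensor (H ⊗[k] H))
    ∘ₗ (TensorProduct.tensorTensorTensorComm k (H ⊗[k] H) H (H ⊗[k] H) H).toLinearMap
    ∘ₗ (TensorProduct.map
          (((Coalgebra.comul (R := k)).rTensor H) ∘ₗ (Coalgebra.comul (R := k)))
          (((Coalgebra.comul (R := k)).rTensor H) ∘ₗ (Coalgebra.comul (R := k))))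

/-- `u(h) = σ(h₂ ⊗ S h₁)`. -/
noncomputable def uF (σ : (H ⊗[k] H) →ₗ[k] k) : H →ₗ[k] k :=
  σ ∘ₗ (TensorProduct.comm k H H).toLinearMap
    ∘ₗ ((HopfAlgebra.antipode (R := k)).rTensor H) ∘ₗ (Coalgebra.comul (R := k))

/-- `v(h) = σ(h₁ ⊗ S h₂)`. -/
noncomputable def vF (σ : (H ⊗[k] H) →ₗ[k] k) : H →ₗ[k] k :=
  σ ∘ₗ (LinearMap.lTensor H (HopfAlgebra.antipode (R := k))) ∘ₗ (Coalgebra.comul (R := k))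

/-- `u⁻¹(h) = σ(S²(h₂) ⊗ h₁)`. -/
noncomputable def uinvF (σ : (H ⊗[k] H) →ₗ[k] k) : H →ₗ[k] k :=
  σ ∘ₗ (((HopfAlgebra.antipode (R := k)) ∘ₗ (HopfAlgebra.antipode (R := k))).rTensor H)
    ∘ₗ (TensorProduct.comm k H H).toLinearMap ∘ₗ (Coalgebra.comul (R := k))

/-- `v⁻¹(h) = σ(S²(h₁) ⊗ h₂)`. -/
noncomputable def vinvF (σ : (H ⊗[k] H) →ₗ[k] k) : H →ₗ[k] k :=
  σ ∘ₗ (((HopfAlgebra.antipode (R := k)) ∘ₗ (HopfAlgebra.antipode (R := k))).rTensor H)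
    ∘ₗ (Coalgebra.comul (R := k))

@[simp]
lemma lap_tmul (f : H →ₗ[k] k) (x y : H) : lap f (x ⊗ₜ[k] y) = f x • y := by
  simp [lap]

@[simp]
lemma rap_tmul (f : H →ₗ[k] k) (x y : H) : rap f (x ⊗ₜ[k] y) = f y • x := by
  simp [rap]

lemma lap_lTensor (f : H →ₗ[k] k) (g : H →ₗ[k] H) (z : H ⊗[k] H) :
    lap f (g.lTensor H z) = g (lap f z) := by
  induction z with
  | zero => simp
  | tmul x y => simp
  | add x y hx hy => simp [hx, hy]

lemma lap_rTensor (f : H →ₗ[k] k) (g : H →ₗ[k] H) (z : H ⊗[k] H) :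
    lap f (g.rTensor H z) = lap (f ∘ₗ g) z := by
  induction z with
  | zero => simp
  | tmul x y => simp
  | add x y hx hy => simp [hx, hy]

lemma apply_lap (f p : H →ₗ[k] k) (z : H ⊗[k] H) : p (lap f z) = f (rap p z) := by
  induction z with
  | zero => simp
  | tmul x y => simp [mul_comm]
  | add x y hx hy => simp [hx, hy]

lemma lap_counit_comul (h : H) : lap (counit (R := k)) (comul (R := k) h) = h := by
  simp [lap]

lemma lap_mul_tmul (f : H →ₗ[k] k) (u : H ⊗[k] H) (x y : H) :
    lap f (u * x ⊗ₜ[k] y) = lap f (u * x ⊗ₜ[k] 1) * y := by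
  induction u with
  | zero => simp
  | tmul p q => simp [Algebra.TensorProduct.tmul_mul_tmul]
  | add p q hp hq => simp [add_mul, hp, hq]

lemma lap_mul_tmul_one (f : H →ₗ[k] k) (u : H ⊗[k] H) (x : H) :
    lap f (u * x ⊗ₜ[k] 1) = lap (f ∘ₗ LinearMap.mulRight k x) u := by
  induction u with
  | zero => simp
  | tmul p q => simp [Algebra.TensorProduct.tmul_mul_tmul]
  | add p q hp hq => simp [add_mul, hp, hq]

/-- `M(l₁) l₂ S(l₃) = M(l)`. -/
lemma mul_map_mul_antipode (M : H →ₗ[k] H) (l : H) :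
    LinearMap.mul' k H (TensorProduct.map (LinearMap.mul' k H ∘ₗ M.rTensor H ∘ₗ comul (R := k))
      (antipode k) (comul (R := k) l)) = M l := by
  have key : LinearMap.mul' k H ∘ₗ
        TensorProduct.map (LinearMap.mul' k H ∘ₗ M.rTensor H) (antipode k)
      = LinearMap.mul' k H ∘ₗ
        TensorProduct.map M (LinearMap.mul' k H ∘ₗ (antipode k).lTensor H) ∘ₗ
        (TensorProduct.assoc k H H H).toLinearMap := by
    ext x y z
    simp [mul_assoc]
  calc _ = (LinearMap.mul' k H ∘ₗ
        TensorProduct.map (LinearMap.mul' k H ∘ₗ M.rTensor H) (antipode k))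
          ((comul (R := k)).rTensor H (comul (R := k) l)) := by
        rw [LinearMap.comp_apply, LinearMap.map_rTensor]
        rfl
    _ = LinearMap.mul' k H (TensorProduct.map M (Algebra.linearMap k H ∘ₗ counit (R := k))
          (comul (R := k) l)) := by
        rw [key, ← mul_antipode_lTensor_comul, LinearMap.comp_apply, LinearMap.comp_apply,
          LinearEquiv.coe_coe, coassoc_apply, LinearMap.map_lTensor]
        rfl
    _ = M l := by
        rw [← LinearMap.map_lTensor, lTensor_counit_comul]
        simp

/-- If `lam(x₁) x₂ = lam(x) b` for all `x`, then `lam(h₁ l) h₂ = lam(h l₁) b S(l₂)`. -/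
lemma lap_mulRight_comul {lam : H →ₗ[k] k} {b : H}
    (hb : ∀ h : H, lap lam (comul (R := k) h) = lam h • b) (h l : H) :
    lap (lam ∘ₗ LinearMap.mulRight k l) (comul (R := k) h) =
      (LinearMap.mulLeft k b ∘ₗ antipode k)
        (lap (lam ∘ₗ LinearMap.mulLeft k h) (comul (R := k) l)) := by
  let M : H →ₗ[k] H := lap lam ∘ₗ LinearMap.mulLeft k (comul (R := k) h) ∘ₗ
    (TensorProduct.mk k H H).flip 1
  have hM : LinearMap.mul' k H ∘ₗ M.rTensor H ∘ₗ comul (R := k) =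
      (lam ∘ₗ LinearMap.mulLeft k h).smulRight b := by
    have : LinearMap.mul' k H ∘ₗ M.rTensor H =
        lap lam ∘ₗ LinearMap.mulLeft k (comul (R := k) h) := by
      ext x y
      simp [M, lap_mul_tmul lam _ x y]
    ext x
    rw [← LinearMap.comp_assoc, this]
    simp [← Bialgebra.comul_mul, hb]
  have hMl : M l = lap (lam ∘ₗ LinearMap.mulRight k l) (comul (R := k) h) := by
    simp [M, lap_mul_tmul_one]
  rw [← hMl, ← mul_map_mul_antipode M l, hM]
  induction comul (R := k) l with
  | zero => simp
  | tmul x y => simp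
  | add x y hx hy => simp only [map_add, hx, hy]

/-- Slices `lam(z₁ h) z₂` vanishing for all `h` force `lam(z₁ S(z₂) m) = 0`. -/
lemma apply_mul_antipode_eq_zero {lam : H →ₗ[k] k} {z : H ⊗[k] H}
    (hz : ∀ h : H, lap (lam ∘ₗ LinearMap.mulRight k h) z = 0) (m : H) :
    lam (LinearMap.mul' k H ((antipode k).lTensor H z) * m) = 0 := by
  let e := Module.Free.chooseBasis k H
  obtain ⟨c, rfl⟩ := (TensorProduct.equivFinsuppOfBasisRight (M := H) e).symm.surjective z
  have hc (i) (h : H) : lam (c i * h) = 0 := by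
    have := congrArg (e.coord i) (hz h)
    rwa [apply_lap, rap, LinearMap.comp_apply (TensorProduct.rid k H).toLinearMap,
      LinearEquiv.coe_coe, ← TensorProduct.equivFinsuppOfBasisRight_apply,
      LinearEquiv.apply_symm_apply, map_zero] at this
  rw [TensorProduct.equivFinsuppOfBasisRight_symm_apply]
  simp [Finsupp.sum, Finset.sum_mul, mul_assoc, hc]

/-- Slices `lam(z₁ h) z₂` vanishing for all `h` force `ε(z₁) z₂ = 0`. -/
lemma lap_counit_eq_zero {lam : H →ₗ[k] k} (hlam : lam ≠ 0) {b : H}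
    (hb : ∀ h : H, lap lam (comul (R := k) h) = lam h • b) {z : H ⊗[k] H}
    (hz : ∀ h : H, lap (lam ∘ₗ LinearMap.mulRight k h) z = 0) :
    lap (counit (R := k)) z = 0 := by
  have nondeg (x : H) (hx : ∀ h : H, lam (x * h) = 0) : counit (R := k) x = 0 := by
    obtain ⟨m, hm⟩ : ∃ m, lam m ≠ 0 := by
      by_contra! hcon
      exact hlam (LinearMap.ext hcon)
    have hx' : lam ∘ₗ LinearMap.mulLeft k x = 0 := LinearMap.ext hx
    have h0 := apply_mul_antipode_eq_zero (lam := lam) (z := comul (R := k) x)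
      (fun h => by rw [lap_mulRight_comul hb, hx']; simp [lap]) m
    simpa [← Algebra.smul_def, hm] using h0
  rw [← Module.forall_dual_apply_eq_zero_iff k]
  intro p
  rw [apply_lap]
  refine nondeg _ fun h => ?_
  simpa [hz h] using (apply_lap (lam ∘ₗ LinearMap.mulRight k h) p z).symm

/-- A Nakayama map `χ` for `lam` is determined by the functional `ε ∘ χ`. -/
lemma nakayama_eq {lam : H →ₗ[k] k} (hlam : lam ≠ 0) {b : H}
    (hb : ∀ h : H, lap lam (comul (R := k) h) = lam h • b) {χ : H →ₗ[k] H}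
    (hχ : ∀ h l : H, lam (l * h) = lam (χ h * l)) (l : H) :
    χ l = b * antipode k
      (b * antipode k (lap (counit (R := k) ∘ₗ χ) (comul (R := k) l))) := by
  set g : H →ₗ[k] H := LinearMap.mulLeft k b ∘ₗ antipode k with hg
  have hz := lap_counit_eq_zero hlam hb
    (z := comul (R := k) (χ l) - χ.rTensor H ((g ∘ₗ g).lTensor H (comul (R := k) l))) ?_
  · rw [map_sub, lap_counit_comul, sub_eq_zero, lap_rTensor, lap_lTensor] at hz
    simpa [hg] using hz
  · intro h
    have h₁ : lam ∘ₗ LinearMap.mulLeft k (χ l) = lam ∘ₗ LinearMap.mulRight k l :=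
      LinearMap.ext fun y => (hχ l y).symm
    have h₂ : (lam ∘ₗ LinearMap.mulRight k h) ∘ₗ χ = lam ∘ₗ LinearMap.mulLeft k h :=
      LinearMap.ext fun y => (hχ y h).symm
    rw [map_sub, sub_eq_zero, lap_mulRight_comul hb, h₁, lap_mulRight_comul hb, lap_rTensor,
      lap_lTensor, h₂]
    rfl

lemma sw3_eq_rap_lap (f : H →ₗ[k] k) (g : H →ₗ[k] H) (p : H →ₗ[k] k) (h : H) :
    sw3 f g p h = g (rap p (comul (R := k) (lap f (comul (R := k) h)))) := by
  have h₁ (t : H ⊗[k] (H ⊗[k] H)) :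
      TensorProduct.lid k H (TensorProduct.rid k (k ⊗[k] H)
        (TensorProduct.map (TensorProduct.map f g) p ((TensorProduct.assoc k H H H).symm t))) =
      g (rap p (TensorProduct.lid k (H ⊗[k] H) (f.rTensor (H ⊗[k] H) t))) := by
    induction t with
    | zero => simp
    | add x y hx hy => simp only [map_add, hx, hy]
    | tmul x t =>
      induction t with
      | zero => simp
      | add x y hx hy => simp only [TensorProduct.tmul_add, map_add, hx, hy]
      | tmul y w => simp [smul_smul, mul_comm]
  have h₂ (z : H ⊗[k] H) :
      TensorProduct.lid k (H ⊗[k] H) (f.rTensor (H ⊗[k] H) ((comul (R := k)).lTensor H z)) =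
      comul (R := k) (lap f z) := by
    induction z with
    | zero => simp
    | add x y hx hy => simp only [map_add, hx, hy]
    | tmul x y => simp
  rw [← h₂, ← h₁, coassoc_symm_apply]
  rfl

lemma lap_comul_lap_antipode (α : H →ₐ[k] k) (h : H) :
    lap α.toLinearMap (comul (R := k)
      (lap (α.toLinearMap ∘ₗ antipode k) (comul (R := k) h))) = h := by
  have h₁ (t : (H ⊗[k] H) ⊗[k] H) :
      lap α.toLinearMap (TensorProduct.lid k (H ⊗[k] H)
        ((α.toLinearMap ∘ₗ antipode k).rTensor (H ⊗[k] H) (TensorProduct.assoc k H H H t))) =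
      lap α.toLinearMap
        ((LinearMap.mul' k H ∘ₗ (antipode k).rTensor H).rTensor H t) := by
    induction t with
    | zero => simp
    | add x y hx hy => simp only [map_add, hx, hy]
    | tmul t w =>
      induction t with
      | zero => simp
      | add x y hx hy => simp only [TensorProduct.add_tmul, map_add, hx, hy]
      | tmul x y => simp [smul_smul]
  have h₂ (z : H ⊗[k] H) :
      comul (R := k) (lap (α.toLinearMap ∘ₗ antipode k) z) =
      TensorProduct.lid k (H ⊗[k] H) ((α.toLinearMap ∘ₗ antipode k).rTensor (H ⊗[k] H)
        ((comul (R := k)).lTensor H z)) := by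
    induction z with
    | zero => simp
    | add x y hx hy => simp only [map_add, hx, hy]
    | tmul x y => simp
  rw [h₂, ← coassoc_apply, h₁, ← LinearMap.rTensor_comp_apply, LinearMap.comp_assoc,
    mul_antipode_rTensor_comul, LinearMap.rTensor_comp_apply, rTensor_counit_comul]
  simp

/-- Radford–Drinfeld formula for $S^4$ in a co-Frobenius Hopf algebra:
$S^4(h) = α^{-1}(h_1)\,a h_2 a^{-1}\,α(h_3)$, where $α^{-1} = α ∘ S$ and $a^{-1} = S(a)$. -/
theorem antipode_pow_four_eq
    (lam : H →ₗ[k] k) (hlam_ne : lam ≠ 0)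
    (hlam_int : ∀ f : H →ₗ[k] k, conv f lam = f 1 • lam)
    (a : H) (ha_ne : a ≠ 0) (ha_grp : Coalgebra.comul (R := k) a = a ⊗ₜ[k] a)
    (ha_mod : ∀ h : H, lT lam h = lam h • (𝐒 a))
    (ha_S2 : ∀ h : H, lam (𝐒 (𝐒 h)) = lam (a * h * 𝐒 a))
    (Sinv : H →ₗ[k] H) (hSinv_l : ∀ h : H, Sinv (𝐒 h) = h)
    (hSinv_r : ∀ h : H, 𝐒 (Sinv h) = h)
    (α : H →ₐ[k] k)
    (hα : ∀ h l : H, lam (l * h) = lam ((chiMap Sinv α.toLinearMap h) * l)) :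
    ∀ h : H, 𝐒 (𝐒 (𝐒 (𝐒 h))) =
      sw3 (α.toLinearMap ∘ₗ (𝐒 : H →ₗ[k] H))
        ((LinearMap.mulLeft k a) ∘ₗ (LinearMap.mulRight k (𝐒 a)))
        α.toLinearMap h := by
  intro h
  have ha : IsGroupLikeElem k a := by
    refine ⟨?_, ha_grp⟩
    have := lap_counit_comul (k := k) a
    rw [ha_grp, lap_tmul] at this
    exact smul_left_injective k ha_ne (by simpa using this)
  have hSa : 𝐒 a * a = 1 := ha.antipode_mul_cancel
  have haS : a * 𝐒 a = 1 := ha.mul_antipode_cancel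
  have hSS : 𝐒 (𝐒 a) = a := by
    have h₁ : 𝐒 a * 𝐒 (𝐒 a) = 1 := by
      rw [← antipode_mul_antidistrib, hSa, antipode_one]
    calc 𝐒 (𝐒 a) = a * (𝐒 a * 𝐒 (𝐒 a)) := by rw [← mul_assoc, haS, one_mul]
      _ = a := by rw [h₁, mul_one]
  have hcounit (x : H) : counit (R := k) (Sinv x) = counit (R := k) x := by
    rw [← counit_antipode, hSinv_r]
  have hχε : counit (R := k) ∘ₗ chiMap Sinv α.toLinearMap = α.toLinearMap := by
    ext l
    have h₁ (z : H ⊗[k] H) : counit (R := k) (TensorProduct.rid k H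
        (TensorProduct.map (Sinv ∘ₗ Sinv) α.toLinearMap z)) =
        α (lap (counit (R := k)) z) := by
      induction z with
      | zero => simp
      | tmul x y => simp [hcounit, mul_comm]
      | add x y hx hy => simp only [map_add, hx, hy]
    exact (h₁ _).trans (by rw [lap_counit_comul]; rfl)
  have hSSχ (l : H) : 𝐒 (𝐒 (chiMap Sinv α.toLinearMap l)) =
      rap α.toLinearMap (comul (R := k) l) := by
    have h₁ (z : H ⊗[k] H) : 𝐒 (𝐒 (TensorProduct.rid k H
        (TensorProduct.map (Sinv ∘ₗ Sinv) α.toLinearMap z))) = rap α.toLinearMap z := by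
      induction z with
      | zero => simp
      | tmul x y => simp [hSinv_r]
      | add x y hx hy => simp only [map_add, hx, hy]
    exact h₁ _
  rw [sw3_eq_rap_lap, ← hSSχ, nakayama_eq hlam_ne ha_mod hα, hχε, lap_comul_lap_antipode]
  simp only [antipode_mul_antidistrib, hSS, LinearMap.comp_apply, LinearMap.mulLeft_apply,
    LinearMap.mulRight_apply]
  simp only [mul_assoc, haS, mul_one]
  simp only [← mul_assoc, haS, one_mul]
end

section
/- Suppose w ∈ H is an invertible element such that S²(h) = w·h·w⁻¹ for all h ∈ H. Then χ(w⁻¹)·w = α(a⁻¹)·1, where χ(h) = α(h₂)S⁻²(h₁). If moreover ε(w) = 1, then α(w⁻¹) = α(a⁻¹). -/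
open TensorProduct Coalgebra HopfAlgebra

variable {k H : Type*} [Field k] [Ring H] [HopfAlgebra k H]

/-- The antipode of `H`, as a linear map. -/
local notation "𝐒" => HopfAlgebra.antipode (R := k)

/-- The right translation `h ↦ f(h₂) • h₁`. -/
noncomputable def rT (f : H →ₗ[k] k) : H →ₗ[k] H :=
  rap f ∘ₗ Coalgebra.comul (R := k)

theorem rT_rT (f g : H →ₗ[k] k) (h : H) : rT f (rT g h) = rT (conv f g) h := by
  let Φ : H ⊗[k] (H ⊗[k] H) →ₗ[k] H :=
    (TensorProduct.rid k H).toLinearMap ∘ₗ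
      LinearMap.lTensor H (LinearMap.mul' k k ∘ₗ TensorProduct.map f g)
  have h_left : ∀ t : H ⊗[k] H,
      rT f (rap g t) =
        Φ (TensorProduct.assoc k H H H ((Coalgebra.comul (R := k)).rTensor H t)) := by
    intro t
    induction t with
    | zero => simp
    | add s t hs ht => simp only [map_add, hs, ht]
    | tmul x y =>
      simp only [rT, rap, LinearMap.comp_apply, LinearMap.lTensor_tmul, LinearMap.rTensor_tmul,
        LinearEquiv.coe_coe, TensorProduct.rid_tmul, map_smul]
      induction Coalgebra.comul (R := k) x with
      | zero => simp
      | add s t hs ht => simp only [map_add, smul_add, TensorProduct.add_tmul, hs, ht]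
      | tmul u v => simp [Φ, smul_smul, mul_comm]
  have h_right : ∀ t : H ⊗[k] H,
      Φ ((Coalgebra.comul (R := k)).lTensor H t) = rap (conv f g) t := by
    intro t
    induction t with
    | zero => simp
    | add s t hs ht => simp only [map_add, hs, ht]
    | tmul x y => simp [Φ, rap, conv]
  calc rT f (rT g h) = rT f (rap g (Coalgebra.comul (R := k) h)) := rfl
    _ = rT (conv f g) h := by
      rw [h_left, Coalgebra.coassoc_apply, h_right]
      rfl

theorem rT_counit (h : H) : rT (Coalgebra.counit (R := k)) h = h := by
  simp [rT, rap]

theorem conv_antipode (α : H →ₐ[k] k) :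
    conv α.toLinearMap (α.toLinearMap ∘ₗ HopfAlgebra.antipode (R := k)) =
      Coalgebra.counit (R := k) := by
  ext h
  have h_factor : ∀ t : H ⊗[k] H,
      LinearMap.mul' k k (TensorProduct.map α.toLinearMap
        (α.toLinearMap ∘ₗ HopfAlgebra.antipode (R := k)) t) =
      α (LinearMap.mul' k H ((HopfAlgebra.antipode (R := k)).lTensor H t)) := by
    intro t
    induction t with
    | zero => simp
    | add s t hs ht => simp only [map_add, hs, ht]
    | tmul x y => simp
  calc conv α.toLinearMap (α.toLinearMap ∘ₗ HopfAlgebra.antipode (R := k)) h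
      = α (LinearMap.mul' k H ((HopfAlgebra.antipode (R := k)).lTensor H
          (Coalgebra.comul (R := k) h))) := h_factor _
    _ = Coalgebra.counit (R := k) h := by
      rw [HopfAlgebra.mul_antipode_lTensor_comul_apply]
      simp

theorem chiMap_apply (Sinv : H →ₗ[k] H) (f : H →ₗ[k] k) (h : H) :
    chiMap Sinv f h = Sinv (Sinv (rT f h)) := by
  simp only [chiMap, rT, rap, LinearMap.comp_apply]
  induction Coalgebra.comul (R := k) h with
  | zero => simp
  | add s t hs ht => simp only [map_add, hs, ht]
  | tmul x y => simp

theorem counit_rT (f : H →ₗ[k] k) (h : H) : Coalgebra.counit (R := k) (rT f h) = f h := by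
  have h_swap : ∀ t : H ⊗[k] H, Coalgebra.counit (R := k) (rap f t) =
      f (TensorProduct.lid k H ((Coalgebra.counit (R := k)).rTensor H t)) := by
    intro t
    induction t with
    | zero => simp
    | add s t hs ht => simp only [map_add, hs, ht]
    | tmul x y => simp [rap, mul_comm]
  calc Coalgebra.counit (R := k) (rT f h)
      = f (TensorProduct.lid k H ((Coalgebra.counit (R := k)).rTensor H
          (Coalgebra.comul (R := k) h))) := h_swap _
    _ = f h := by simp

theorem isGroupLikeElem_of_comul {a : H} (ha_ne : a ≠ 0)
    (ha_grp : Coalgebra.comul (R := k) a = a ⊗ₜ[k] a) : IsGroupLikeElem k a := by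
  refine ⟨?_, ha_grp⟩
  have h_counit := rT_counit (k := k) a
  simp only [rT, rap, LinearMap.comp_apply, ha_grp, LinearMap.lTensor_tmul, LinearEquiv.coe_coe,
    TensorProduct.rid_tmul] at h_counit
  refine smul_left_injective k ha_ne ?_
  simpa using h_counit

/-- If $S^2$ is inner, induced by an invertible $w$, then
$χ(w^{-1})w = α(a^{-1})1$; if moreover $ε(w) = 1$ then $α(w^{-1}) = α(a^{-1})$. -/
theorem chi_inv_of_inner
    (lam : H →ₗ[k] k) (hlam_ne : lam ≠ 0)
    (hlam_int : ∀ f : H →ₗ[k] k, conv f lam = f 1 • lam)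
    (a : H) (ha_ne : a ≠ 0) (ha_grp : Coalgebra.comul (R := k) a = a ⊗ₜ[k] a)
    (ha_mod : ∀ h : H, lT lam h = lam h • (𝐒 a))
    (ha_S2 : ∀ h : H, lam (𝐒 (𝐒 h)) = lam (a * h * 𝐒 a))
    (Sinv : H →ₗ[k] H) (hSinv_l : ∀ h : H, Sinv (𝐒 h) = h)
    (hSinv_r : ∀ h : H, 𝐒 (Sinv h) = h)
    (α : H →ₐ[k] k)
    (hα : ∀ h l : H, lam (l * h) = lam ((chiMap Sinv α.toLinearMap h) * l))
    (hinj_r : ∀ h h' : H, (∀ l : H, lam (l * h) = lam (l * h')) → h = h')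
    (w w' : H) (hw_r : w * w' = 1) (hw_l : w' * w = 1)
    (hS2w : ∀ h : H, 𝐒 (𝐒 h) = w * h * w') :
    chiMap Sinv α.toLinearMap w' * w = α (𝐒 a) • (1 : H) ∧
      (Coalgebra.counit (R := k) w = 1 → α w' = α (𝐒 a)) := by
  have ha : IsGroupLikeElem k a := isGroupLikeElem_of_comul ha_ne ha_grp
  have ha_l : 𝐒 a * a = 1 := ha.antipode_mul_cancel
  have hSa : IsGroupLikeElem k (𝐒 a) := ha.antipode
  have hSSa : 𝐒 (𝐒 a) = a := ha.antipode_antipode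
  have hχa : chiMap Sinv α.toLinearMap (𝐒 a) = α (𝐒 a) • 𝐒 a := by
    have h_inv : Sinv (Sinv (𝐒 a)) = 𝐒 a := by
      rw [hSinv_l]
      nth_rewrite 1 [← hSSa]
      exact hSinv_l _
    simp [chiMap_apply, rT, rap, hSa.comul_eq_tmul_self, h_inv]
  have hSinv_sq : ∀ h, Sinv (Sinv h) = w' * h * w := by
    intro h
    have h_conj : 𝐒 (𝐒 (w' * h * w)) = h := by
      rw [hS2w, ← mul_assoc, ← mul_assoc, hw_r, one_mul, mul_assoc, hw_r, mul_one]
    nth_rewrite 1 [← h_conj]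
    rw [hSinv_l, hSinv_l]
  have hχ_surj : Function.Surjective (chiMap Sinv α.toLinearMap) := by
    intro z
    refine ⟨rT (α.toLinearMap ∘ₗ 𝐒) (w * z * w'), ?_⟩
    rw [chiMap_apply, rT_rT, conv_antipode, rT_counit, hSinv_sq,
      ← mul_assoc, ← mul_assoc, hw_l, one_mul, mul_assoc, hw_l, mul_one]
  have hinj_l : ∀ x y : H, (∀ l, lam (x * l) = lam (y * l)) → x = y := by
    intro x y hxy
    obtain ⟨x, rfl⟩ := hχ_surj x
    obtain ⟨y, rfl⟩ := hχ_surj y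
    exact congrArg _ (hinj_r x y fun l => by rw [hα x, hα y, hxy])
  have h_main : chiMap Sinv α.toLinearMap w' * w = α (𝐒 a) • (1 : H) := by
    refine hinj_l _ _ fun l => ?_
    calc lam (chiMap Sinv α.toLinearMap w' * w * l) = lam (w * l * w') := by
          rw [mul_assoc, ← hα]
      _ = lam (a * l * 𝐒 a) := by rw [← hS2w, ha_S2]
      _ = lam (α (𝐒 a) • (1 : H) * l) := by
          rw [hα, hχa, smul_mul_assoc, ← mul_assoc, ha_l, smul_mul_assoc]
  refine ⟨h_main, fun hw => ?_⟩
  have hw' : Coalgebra.counit (R := k) w' = 1 := by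
    have h_counit := congrArg (Coalgebra.counit (R := k)) hw_r
    simpa [Bialgebra.counit_mul, hw] using h_counit
  have h_counit := congrArg (Coalgebra.counit (R := k)) h_main
  rw [chiMap_apply, hSinv_sq] at h_counit
  simpa [Bialgebra.counit_mul, hw, hw', counit_rT] using h_counit
end

section
/- For any algebra maps η, ν : H → k, the element a_η := η(R¹)R² is a grouplike element of H and a_{η*ν} = a_η·a_ν; likewise b_η := η(S⁻¹(R²))R¹ is a grouplike element of H and b_{η*ν} = b_η·b_ν. Thus η ↦ a_η and η ↦ b_η are group homomorphisms from the group of algebra maps H → k (under convolution) to the group of grouplike elements of H. -/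
open TensorProduct Coalgebra HopfAlgebra

variable {k H : Type*} [Field k] [Ring H] [HopfAlgebra k H]

/-- The antipode of `H`, as a linear map. -/
local notation "𝐒" => HopfAlgebra.antipode (R := k)

section DualGroup

open WithConv

lemma conv_eq_ofConv_mul (f g : H →ₗ[k] k) : conv f g = (toConv f * toConv g).ofConv := rfl

/-- The convolution product of two characters of `H`. -/
noncomputable def convChar (η ν : H →ₐ[k] k) : H →ₐ[k] k :=
  (toConv η * toConv ν).ofConv

lemma toLinearMap_convChar (η ν : H →ₐ[k] k) :
    (convChar η ν).toLinearMap = conv η.toLinearMap ν.toLinearMap := rfl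

/-- The character `η ∘ S` of `H`. -/
noncomputable def charInv (η : H →ₐ[k] k) : H →ₐ[k] k :=
  AlgHom.ofLinearMap (η.toLinearMap ∘ₗ 𝐒) (by simp)
    (fun x y => by simp [antipode_mul_antidistrib, mul_comm])

lemma toLinearMap_charInv (η : H →ₐ[k] k) :
    (charInv η).toLinearMap = η.toLinearMap ∘ₗ 𝐒 := rfl

lemma toConv_comp_one (η : H →ₐ[k] k) :
    toConv (η.toLinearMap ∘ₗ (1 : WithConv (H →ₗ[k] H)).ofConv) = 1 := by
  ext h
  simp [LinearMap.convOne_def]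

lemma char_mul_charInv (η : H →ₐ[k] k) :
    toConv η.toLinearMap * toConv (charInv η).toLinearMap = 1 := by
  rw [← toConv_comp_one η, ← LinearMap.id_mul_antipode,
    LinearMap.algHom_comp_convMul_distrib]
  rfl

lemma charInv_mul_char (η : H →ₐ[k] k) :
    toConv (charInv η).toLinearMap * toConv η.toLinearMap = 1 := by
  rw [← toConv_comp_one η, ← LinearMap.antipode_mul_id,
    LinearMap.algHom_comp_convMul_distrib]
  rfl

lemma charInv_charInv (η : H →ₐ[k] k) : charInv (charInv η) = η := by
  apply AlgHom.toLinearMap_injective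
  apply toConv_injective
  exact (left_inv_eq_right_inv (char_mul_charInv η) (char_mul_charInv (charInv η))).symm

lemma charInv_convChar (η ν : H →ₐ[k] k) :
    (charInv (convChar η ν)).toLinearMap =
      conv (charInv ν).toLinearMap (charInv η).toLinearMap := by
  apply toConv_injective
  refine (left_inv_eq_right_inv (a := toConv (convChar η ν).toLinearMap) ?_
    (char_mul_charInv _)).symm
  rw [toLinearMap_convChar, conv_eq_ofConv_mul, conv_eq_ofConv_mul, toConv_ofConv, toConv_ofConv,
    mul_assoc, ← mul_assoc (toConv (charInv η).toLinearMap), charInv_mul_char, one_mul,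
    charInv_mul_char]

lemma char_comp_eq_charInv {Sinv : H →ₗ[k] H} (hSinv : ∀ h : H, 𝐒 (Sinv h) = h)
    (η : H →ₐ[k] k) : η.toLinearMap ∘ₗ Sinv = (charInv η).toLinearMap := by
  ext h
  nth_rw 1 [← charInv_charInv η]
  simp [toLinearMap_charInv, hSinv]

end DualGroup

section Contraction

open Algebra.TensorProduct

lemma counit_lap (f : H →ₗ[k] k) (R : H ⊗[k] H) :
    counit (R := k) (lap f R) = f (rap (counit (R := k)) R) := by
  induction R with
  | zero => simp
  | tmul x y => simp [lap, rap, mul_comm]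
  | add x y hx hy => simp only [map_add, hx, hy]

lemma counit_rap (f : H →ₗ[k] k) (R : H ⊗[k] H) :
    counit (R := k) (rap f R) = f (lap (counit (R := k)) R) := by
  induction R with
  | zero => simp
  | tmul x y => simp [lap, rap, mul_comm]
  | add x y hx hy => simp only [map_add, hx, hy]

variable {R : H ⊗[k] H}

lemma lap_ne_zero (h : rap (counit (R := k)) R = 1) (η : H →ₐ[k] k) :
    lap η.toLinearMap R ≠ 0 := by
  intro h0
  simpa [h0, h] using counit_lap η.toLinearMap R

lemma rap_ne_zero (h : lap (counit (R := k)) R = 1) (η : H →ₐ[k] k) :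
    rap η.toLinearMap R ≠ 0 := by
  intro h0
  simpa [h0, h] using counit_rap η.toLinearMap R

lemma lap_conv
    (hR : (comul (R := k)).rTensor H R =
      ((includeLeft : H →ₐ[k] (H ⊗[k] H)).toLinearMap.rTensor H R) *
      ((includeRight : H →ₐ[k] (H ⊗[k] H)).toLinearMap.rTensor H R))
    (η ν : H →ₐ[k] k) :
    lap (conv η.toLinearMap ν.toLinearMap) R = lap η.toLinearMap R * lap ν.toLinearMap R := by
  let Φ : (H ⊗[k] H) ⊗[k] H →ₐ[k] H :=
    (Algebra.TensorProduct.lid k H).toAlgHom.comp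
      (Algebra.TensorProduct.map ((lmul' k).comp (Algebra.TensorProduct.map η ν)) (.id k H))
  have hΦ := congrArg Φ hR
  rw [map_mul] at hΦ
  convert hΦ using 1
  · generalize R = T
    induction T with
    | zero => simp
    | tmul x y =>
      simp only [lap, conv, Φ, LinearMap.comp_apply, LinearMap.rTensor_tmul]
      rfl
    | add x y hx hy => simp only [map_add, hx, hy]
  · congr 1 <;> generalize R = T <;> induction T with
    | zero => simp
    | tmul x y => simp [lap, Φ]
    | add x y hx hy => simp only [map_add, hx, hy]

lemma rap_conv
    (hR : (comul (R := k)).lTensor H R =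
      (LinearMap.lTensor H (includeRight : H →ₐ[k] (H ⊗[k] H)).toLinearMap R) *
      (LinearMap.lTensor H (includeLeft : H →ₐ[k] (H ⊗[k] H)).toLinearMap R))
    (η ν : H →ₐ[k] k) :
    rap (conv η.toLinearMap ν.toLinearMap) R = rap ν.toLinearMap R * rap η.toLinearMap R := by
  let Φ : H ⊗[k] (H ⊗[k] H) →ₐ[k] H :=
    (Algebra.TensorProduct.rid k k H).toAlgHom.comp
      (Algebra.TensorProduct.map (.id k H) ((lmul' k).comp (Algebra.TensorProduct.map η ν)))
  have hΦ := congrArg Φ hR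
  rw [map_mul] at hΦ
  convert hΦ using 1
  · generalize R = T
    induction T with
    | zero => simp
    | tmul x y =>
      simp only [rap, conv, Φ, LinearMap.comp_apply, LinearMap.lTensor_tmul]
      rfl
    | add x y hx hy => simp only [map_add, hx, hy]
  · congr 1 <;> generalize R = T <;> induction T with
    | zero => simp
    | tmul x y => simp [rap, Φ]
    | add x y hx hy => simp only [map_add, hx, hy]

lemma comul_lap
    (hR : (comul (R := k)).lTensor H R =
      (LinearMap.lTensor H (includeRight : H →ₐ[k] (H ⊗[k] H)).toLinearMap R) *
      (LinearMap.lTensor H (includeLeft : H →ₐ[k] (H ⊗[k] H)).toLinearMap R))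
    (η : H →ₐ[k] k) :
    comul (R := k) (lap η.toLinearMap R) = lap η.toLinearMap R ⊗ₜ[k] lap η.toLinearMap R := by
  let Φ : H ⊗[k] (H ⊗[k] H) →ₐ[k] H ⊗[k] H :=
    (Algebra.TensorProduct.lid k (H ⊗[k] H)).toAlgHom.comp
      (Algebra.TensorProduct.map η (.id k (H ⊗[k] H)))
  have hΦ := congrArg Φ hR
  have hr (T : H ⊗[k] H) :
      Φ (LinearMap.lTensor H (includeRight : H →ₐ[k] (H ⊗[k] H)).toLinearMap T) =
        1 ⊗ₜ lap η.toLinearMap T := by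
    induction T with
    | zero => simp
    | tmul x y => simp [lap, Φ]
    | add x y hx hy => simp only [map_add, hx, hy, tmul_add]
  have hl (T : H ⊗[k] H) :
      Φ (LinearMap.lTensor H (includeLeft : H →ₐ[k] (H ⊗[k] H)).toLinearMap T) =
        lap η.toLinearMap T ⊗ₜ 1 := by
    induction T with
    | zero => simp
    | tmul x y => simp [lap, Φ, smul_tmul']
    | add x y hx hy => simp only [map_add, hx, hy, add_tmul]
  have hc (T : H ⊗[k] H) :
      Φ ((comul (R := k)).lTensor H T) = comul (R := k) (lap η.toLinearMap T) := by
    induction T with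
    | zero => simp
    | tmul x y => simp [lap, Φ]
    | add x y hx hy => simp only [map_add, hx, hy]
  rw [map_mul, hr, hl, hc] at hΦ
  simpa using hΦ

lemma comul_rap
    (hR : (comul (R := k)).rTensor H R =
      ((includeLeft : H →ₐ[k] (H ⊗[k] H)).toLinearMap.rTensor H R) *
      ((includeRight : H →ₐ[k] (H ⊗[k] H)).toLinearMap.rTensor H R))
    (η : H →ₐ[k] k) :
    comul (R := k) (rap η.toLinearMap R) = rap η.toLinearMap R ⊗ₜ[k] rap η.toLinearMap R := by
  let Φ : (H ⊗[k] H) ⊗[k] H →ₐ[k] H ⊗[k] H :=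
    (Algebra.TensorProduct.rid k k (H ⊗[k] H)).toAlgHom.comp
      (Algebra.TensorProduct.map (.id k (H ⊗[k] H)) η)
  have hΦ := congrArg Φ hR
  have hr (T : H ⊗[k] H) :
      Φ ((includeRight : H →ₐ[k] (H ⊗[k] H)).toLinearMap.rTensor H T) =
        1 ⊗ₜ rap η.toLinearMap T := by
    induction T with
    | zero => simp
    | tmul x y => simp [rap, Φ]
    | add x y hx hy => simp only [map_add, hx, hy, tmul_add]
  have hl (T : H ⊗[k] H) :
      Φ ((includeLeft : H →ₐ[k] (H ⊗[k] H)).toLinearMap.rTensor H T) =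
        rap η.toLinearMap T ⊗ₜ 1 := by
    induction T with
    | zero => simp
    | tmul x y => simp [rap, Φ, smul_tmul']
    | add x y hx hy => simp only [map_add, hx, hy, add_tmul]
  have hc (T : H ⊗[k] H) :
      Φ ((comul (R := k)).rTensor H T) = comul (R := k) (rap η.toLinearMap T) := by
    induction T with
    | zero => simp
    | tmul x y => simp [rap, Φ]
    | add x y hx hy => simp only [map_add, hx, hy]
  rw [map_mul, hr, hl, hc] at hΦ
  simpa using hΦ

end Contraction

/-- In a quasitriangular Hopf algebra, for algebra maps $η, ν : H → k$,
the elements $a_η = η(R^1)R^2$ and $b_η = η(S^{-1}(R^2))R^1$ are grouplike and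
$a_{η*ν} = a_η a_ν$, $b_{η*ν} = b_η b_ν$ — i.e. $η ↦ a_η$ and $η ↦ b_η$ are group
homomorphisms from algebra maps (under convolution) to grouplikes. -/
theorem aGrouplike_bGrouplike_hom
    (Sinv : H →ₗ[k] H) (hSinv_l : ∀ h : H, Sinv (𝐒 h) = h)
    (hSinv_r : ∀ h : H, 𝐒 (Sinv h) = h)
    (R U : H ⊗[k] H) (hRU : R * U = 1) (hUR : U * R = 1)
    (hqt4 : ∀ h : H, (TensorProduct.comm k H H) (Coalgebra.comul (R := k) h) =
      R * (Coalgebra.comul (R := k) h) * U)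
    (hqt1 : (Coalgebra.comul (R := k)).rTensor H R =
      (((Algebra.TensorProduct.includeLeft : H →ₐ[k] (H ⊗[k] H))).toLinearMap.rTensor H R) *
      (((Algebra.TensorProduct.includeRight : H →ₐ[k] (H ⊗[k] H))).toLinearMap.rTensor H R))
    (hqt2 : (Coalgebra.comul (R := k)).lTensor H R =
      (LinearMap.lTensor H ((Algebra.TensorProduct.includeRight : H →ₐ[k] (H ⊗[k] H))).toLinearMap R) *
      (LinearMap.lTensor H ((Algebra.TensorProduct.includeLeft : H →ₐ[k] (H ⊗[k] H))).toLinearMap R))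
    (hqt3l : lap (Coalgebra.counit (R := k)) R = 1)
    (hqt3r : rap (Coalgebra.counit (R := k)) R = 1)
    (u' : H) (hu_r : uElt R * u' = 1) (hu_l : u' * uElt R = 1)
    (hS2u : ∀ h : H, 𝐒 (𝐒 h) = uElt R * h * u') :
    ∀ η ν : H →ₐ[k] k,
      (lap η.toLinearMap R ≠ 0) ∧
      (Coalgebra.comul (R := k) (lap η.toLinearMap R) =
        (lap η.toLinearMap R) ⊗ₜ[k] (lap η.toLinearMap R)) ∧
      (lap (conv η.toLinearMap ν.toLinearMap) R = lap η.toLinearMap R * lap ν.toLinearMap R) ∧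
      (rap (η.toLinearMap ∘ₗ Sinv) R ≠ 0) ∧
      (Coalgebra.comul (R := k) (rap (η.toLinearMap ∘ₗ Sinv) R) =
        (rap (η.toLinearMap ∘ₗ Sinv) R) ⊗ₜ[k] (rap (η.toLinearMap ∘ₗ Sinv) R)) ∧
      (rap ((conv η.toLinearMap ν.toLinearMap) ∘ₗ Sinv) R =
        rap (η.toLinearMap ∘ₗ Sinv) R * rap (ν.toLinearMap ∘ₗ Sinv) R) := by
  intro η ν
  refine ⟨lap_ne_zero hqt3r η, comul_lap hqt2 η, lap_conv hqt1 η ν, ?_⟩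
  rw [← toLinearMap_convChar]
  simp only [char_comp_eq_charInv hSinv_r]
  refine ⟨rap_ne_zero hqt3l _, comul_rap hqt1 _, ?_⟩
  rw [charInv_convChar, rap_conv hqt2]
end

section
/- In a co-Frobenius quasitriangular Hopf algebra one has u·v = v·u = a·b_α = a·a_α; that is, S(R²)R¹·S(u)⁻¹ = S(u)⁻¹·S(R²)R¹ = a·α(S⁻¹(R²))R¹ = a·α(R¹)R². -/
open TensorProduct Coalgebra HopfAlgebra

variable {k H : Type*} [Field k] [Ring H] [HopfAlgebra k H]

/-- The antipode of `H`, as a linear map. -/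
local notation "𝐒" => HopfAlgebra.antipode (R := k)

section Contraction

variable (Sinv : H →ₗ[k] H)

theorem sum_inverse_antipode_mul (hSinv_l : ∀ h : H, Sinv (𝐒 h) = h)
    (hSinv_r : ∀ h : H, 𝐒 (Sinv h) = h) {ι : Type*} {x : H} (r : Coalgebra.Repr k x ι) :
    ∑ i ∈ r.index, Sinv (r.right i) * r.left i = counit (R := k) x • 1 := by
  apply Function.LeftInverse.injective hSinv_l
  simp [antipode_mul_antidistrib, hSinv_r, sum_antipode_mul_eq_smul]

theorem sum_one_tmul_inverse_antipode_mul_comul (hSinv_l : ∀ h : H, Sinv (𝐒 h) = h)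
    (hSinv_r : ∀ h : H, 𝐒 (Sinv h) = h) {ι : Type*} {x : H} (r : Coalgebra.Repr k x ι) :
    ∑ i ∈ r.index, (1 ⊗ₜ[k] Sinv (r.right i)) * comul (R := k) (r.left i) = x ⊗ₜ[k] (1 : H) := by
  have h := congrArg (LinearMap.lTensor H (LinearMap.mul' k H ∘ₗ
    (TensorProduct.comm k H H).toLinearMap ∘ₗ LinearMap.lTensor H Sinv))
    (sum_tmul_tmul_eq r (fun i ↦ ℛ k (r.left i)) (fun i ↦ ℛ k (r.right i)))
  simp only [map_sum, LinearMap.lTensor_tmul, LinearMap.comp_apply, LinearEquiv.coe_coe,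
    TensorProduct.comm_tmul, LinearMap.mul'_apply] at h
  simp_rw [← TensorProduct.tmul_sum, sum_inverse_antipode_mul Sinv hSinv_l hSinv_r] at h
  have h' := congrArg (LinearMap.lTensor H (Algebra.linearMap k H)) (sum_tmul_counit_eq r)
  simp only [map_sum, LinearMap.lTensor_tmul, Algebra.linearMap_apply,
    Algebra.algebraMap_eq_smul_one, one_smul] at h'
  rw [← h', ← h]
  refine Finset.sum_congr rfl fun i _ ↦ ?_
  conv_lhs => rw [← (ℛ k (r.left i)).eq]
  simp [Finset.mul_sum]

theorem sum_antipode_tmul_one_mul_comul {ι : Type*} {x : H} (r : Coalgebra.Repr k x ι) :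
    ∑ i ∈ r.index, (𝐒 (r.left i) ⊗ₜ[k] 1) * comul (R := k) (r.right i) = (1 : H) ⊗ₜ[k] x := by
  have h := congrArg (LinearMap.rTensor H (LinearMap.mul' k H ∘ₗ LinearMap.rTensor H 𝐒) ∘ₗ
      (TensorProduct.assoc k H H H).symm.toLinearMap)
    (sum_tmul_tmul_eq r (fun i ↦ ℛ k (r.left i)) (fun i ↦ ℛ k (r.right i)))
  simp only [map_sum, LinearMap.rTensor_tmul, LinearMap.comp_apply, LinearEquiv.coe_coe,
    TensorProduct.assoc_symm_tmul, LinearMap.mul'_apply] at h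
  simp_rw [← TensorProduct.sum_tmul, sum_antipode_mul_eq_smul] at h
  have h' := congrArg (LinearMap.rTensor H (Algebra.linearMap k H)) (sum_counit_tmul_eq r)
  simp only [map_sum, LinearMap.rTensor_tmul, Algebra.linearMap_apply,
    Algebra.algebraMap_eq_smul_one, one_smul] at h'
  rw [← h', h]
  refine Finset.sum_congr rfl fun i _ ↦ ?_
  conv_lhs => rw [← (ℛ k (r.right i)).eq]
  simp [Finset.mul_sum]

/-- Contracting the first leg of `(x ⊗ 1) * Δ h` with a functional satisfying
`lam h₁ • h₂ = lam h • g` moves the coproduct from `h` to `x`. -/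
theorem lap_tmul_one_mul_comul (hSinv_l : ∀ h : H, Sinv (𝐒 h) = h)
    (hSinv_r : ∀ h : H, 𝐒 (Sinv h) = h) (lam : H →ₗ[k] k) (g : H)
    (hr : ∀ h : H, lT lam h = lam h • g) (x h : H) :
    lap lam ((x ⊗ₜ[k] 1) * comul (R := k) h) =
      TensorProduct.lid k H
        (TensorProduct.map (lam ∘ₗ LinearMap.mulRight k h) Sinv (comul (R := k) x)) * g := by
  have hmul : ∀ (y : H) (t : H ⊗[k] H), lap lam ((1 ⊗ₜ[k] y) * t) = y * lap lam t := by
    intro y t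
    induction t with
    | zero => simp
    | add p q hp hq => simp [mul_add, hp, hq]
    | tmul p q => simp [lap]
  have hE : ∀ z : H, lap lam (comul (R := k) z) = lam z • g := hr
  rw [← sum_one_tmul_inverse_antipode_mul_comul Sinv hSinv_l hSinv_r (ℛ k x)]
  conv_rhs => rw [← (ℛ k x).eq]
  simp only [Finset.sum_mul, map_sum, mul_assoc, ← Bialgebra.comul_mul, hmul, hE]
  simp

theorem rap_one_tmul_mul_comul (lam : H →ₗ[k] k)
    (hl : ∀ h : H, rap lam (comul (R := k) h) = lam h • 1) (x h : H) :
    rap lam ((1 ⊗ₜ[k] x) * comul (R := k) h) =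
      TensorProduct.rid k H
        (TensorProduct.map 𝐒 (lam ∘ₗ LinearMap.mulRight k h) (comul (R := k) x)) := by
  have hmul : ∀ (y : H) (t : H ⊗[k] H), rap lam ((y ⊗ₜ[k] 1) * t) = y * rap lam t := by
    intro y t
    induction t with
    | zero => simp
    | add p q hp hq => simp [mul_add, hp, hq]
    | tmul p q => simp [rap]
  rw [← sum_antipode_tmul_one_mul_comul (ℛ k x)]
  conv_rhs => rw [← (ℛ k x).eq]
  simp only [Finset.sum_mul, map_sum, mul_assoc, ← Bialgebra.comul_mul, hmul, hl]
  simp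

end Contraction

theorem rap_comul_eq_of_conv_eq (lam : H →ₗ[k] k)
    (hlam_int : ∀ f : H →ₗ[k] k, conv f lam = f 1 • lam) (h : H) :
    rap lam (comul (R := k) h) = lam h • 1 := by
  rw [← sub_eq_zero, ← Module.forall_dual_apply_eq_zero_iff k]
  intro f
  have key : ∀ t : H ⊗[k] H, f (rap lam t) = LinearMap.mul' k k (TensorProduct.map f lam t) := by
    intro t
    induction t with
    | zero => simp
    | add p q hp hq => simp [hp, hq]
    | tmul p q => simp [rap, mul_comm]
  have := LinearMap.congr_fun (hlam_int f) h
  rw [map_sub, key, map_smul, sub_eq_zero]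
  simpa [conv, mul_comm] using this

theorem sum_comul_tmul {s : Finset (H × H)} {R : H ⊗[k] H} (hs : R = ∑ i ∈ s, i.1 ⊗ₜ[k] i.2)
    (hqt1 : (Coalgebra.comul (R := k)).rTensor H R =
      (((Algebra.TensorProduct.includeLeft : H →ₐ[k] (H ⊗[k] H))).toLinearMap.rTensor H R) *
      (((Algebra.TensorProduct.includeRight : H →ₐ[k] (H ⊗[k] H))).toLinearMap.rTensor H R)) :
    ∑ i ∈ s, comul (R := k) i.1 ⊗ₜ[k] i.2 =
      ∑ i ∈ s, ∑ j ∈ s, (i.1 ⊗ₜ[k] j.1) ⊗ₜ[k] (i.2 * j.2) := by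
  simpa [hs, Finset.sum_mul_sum] using hqt1

/-- `u * g = S u * α(R¹) • R²`, where `g` is the modular element of `H` and `α` that of the dual.
It follows by contracting the first leg of `R * Δ h = Δᵒᵖ h * R` with the integral `lam`,
for an `h` such that `x ↦ lam (x * h)` agrees with the counit on the first legs of `R`. -/
theorem uElt_mul_eq_antipode_uElt_mul_lap (lam : H →ₗ[k] k) (g : H)
    (hr : ∀ h : H, lT lam h = lam h • g)
    (hl : ∀ h : H, rap lam (comul (R := k) h) = lam h • 1)
    (Sinv : H →ₗ[k] H) (hSinv_l : ∀ h : H, Sinv (𝐒 h) = h)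
    (hSinv_r : ∀ h : H, 𝐒 (Sinv h) = h) (α : H →ₐ[k] k)
    (hα : ∀ h l : H, lam (l * h) = lam ((chiMap Sinv α.toLinearMap h) * l))
    (hdense : ∀ (f : H →ₗ[k] k) (s : Finset H), ∃ h : H, ∀ x ∈ s, lam (x * h) = f x)
    (R : H ⊗[k] H)
    (hcomm : ∀ h : H, R * comul (R := k) h = TensorProduct.comm k H H (comul (R := k) h) * R)
    (hqt1 : (Coalgebra.comul (R := k)).rTensor H R =
      (((Algebra.TensorProduct.includeLeft : H →ₐ[k] (H ⊗[k] H))).toLinearMap.rTensor H R) *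
      (((Algebra.TensorProduct.includeRight : H →ₐ[k] (H ⊗[k] H))).toLinearMap.rTensor H R))
    (hε : lap (counit (R := k)) R = 1) (hSS : TensorProduct.map 𝐒 𝐒 R = R) :
    uElt R * g = 𝐒 (uElt R) * lap α.toLinearMap R := by
  classical
  obtain ⟨s, hs⟩ := TensorProduct.exists_finset R
  have hΔ := sum_comul_tmul hs hqt1
  obtain ⟨h, hh⟩ := hdense counit (s.image Prod.fst)
  replace hh : ∀ i ∈ s, lam (i.1 * h) = counit i.1 :=
    fun i hi ↦ hh _ (Finset.mem_image_of_mem _ hi)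
  have hε' : ∑ i ∈ s, counit (R := k) i.1 • i.2 = 1 := by
    simpa [lap, hs] using hε
  have hSR : LinearMap.rTensor H Sinv R = LinearMap.lTensor H 𝐒 R := by
    conv_lhs => rw [← hSS]
    simp [hs, hSinv_l]
  have hSR2 : ∑ i ∈ s, Sinv (Sinv i.1) ⊗ₜ[k] i.2 = ∑ i ∈ s, i.1 ⊗ₜ[k] 𝐒 (𝐒 i.2) := by
    have h1 := congrArg (LinearMap.rTensor H Sinv) hSR
    have h2 := congrArg (LinearMap.lTensor H 𝐒) hSR
    simp only [hs, map_sum, LinearMap.rTensor_tmul, LinearMap.lTensor_tmul] at h1 h2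
    rw [h1, h2]
  have hu : ∑ i ∈ s, i.2 * Sinv i.1 = uElt R := by
    rw [uElt, ← hSR]
    simp [hs]
  have hlap : ∑ i ∈ s, α i.1 • i.2 = lap α.toLinearMap R := by
    simp [lap, hs]
  have hlhs : lap lam (R * comul (R := k) h) = uElt R * g := by
    have h1 := congrArg (LinearMap.mul' k H ∘ₗ (TensorProduct.comm k H H).toLinearMap ∘ₗ
      LinearMap.rTensor H ((TensorProduct.lid k H).toLinearMap ∘ₗ
        TensorProduct.map (lam ∘ₗ LinearMap.mulRight k h) Sinv)) hΔ
    simp only [map_sum, LinearMap.comp_apply, LinearMap.rTensor_tmul, LinearEquiv.coe_coe,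
      TensorProduct.comm_tmul, LinearMap.mul'_apply, TensorProduct.map_tmul,
      TensorProduct.lid_tmul, LinearMap.mulRight_apply] at h1
    have hmul : ∀ (x y : H) (t : H ⊗[k] H),
        lap lam ((x ⊗ₜ[k] y) * t) = y * lap lam ((x ⊗ₜ[k] 1) * t) := by
      intro x y t
      induction t with
      | zero => simp
      | add p q hp hq => simp only [mul_add, map_add, hp, hq]
      | tmul p q => simp [lap]
    conv_lhs => rw [hs]
    have hA : ∀ x y : H, lap lam ((x ⊗ₜ[k] y) * comul (R := k) h) =
        y * TensorProduct.lid k H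
          (TensorProduct.map (lam ∘ₗ LinearMap.mulRight k h) Sinv (comul (R := k) x)) * g := by
      intro x y
      rw [hmul, lap_tmul_one_mul_comul Sinv hSinv_l hSinv_r lam g hr, mul_assoc]
    simp only [Finset.sum_mul, map_sum, hA]
    rw [← Finset.sum_mul, h1, ← hu]
    congr 1
    rw [← one_mul (∑ i ∈ s, i.2 * Sinv i.1), ← hε', Finset.sum_mul_sum]
    refine Finset.sum_congr rfl fun i hi ↦ Finset.sum_congr rfl fun j _ ↦ ?_
    simp [hh i hi, mul_assoc]
  have hχ : ∑ i ∈ s, chiMap Sinv α.toLinearMap i.1 ⊗ₜ[k] i.2 =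
      ∑ i ∈ s, i.1 ⊗ₜ[k] (𝐒 (𝐒 i.2) * lap α.toLinearMap R) := by
    have h1 := congrArg (LinearMap.rTensor H ((TensorProduct.rid k H).toLinearMap ∘ₗ
      TensorProduct.map (Sinv ∘ₗ Sinv) α.toLinearMap)) hΔ
    have h2 := congrArg (LinearMap.lTensor H (LinearMap.mulRight k (lap α.toLinearMap R))) hSR2
    simp only [map_sum, LinearMap.comp_apply, LinearMap.rTensor_tmul, LinearEquiv.coe_coe,
      TensorProduct.map_tmul, TensorProduct.rid_tmul, LinearMap.lTensor_tmul,
      LinearMap.mulRight_apply] at h1 h2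
    rw [← h2, ← hlap]
    refine h1.trans (Finset.sum_congr rfl fun i _ ↦ ?_)
    simp [Finset.mul_sum, TensorProduct.tmul_sum, TensorProduct.smul_tmul]
  have hrhs : lap lam (TensorProduct.comm k H H (comul (R := k) h) * R) =
      𝐒 (uElt R) * lap α.toLinearMap R := by
    have hmul : ∀ (x y : H) (t : H ⊗[k] H),
        lap lam (TensorProduct.comm k H H t * (x ⊗ₜ[k] y)) =
          rap lam ((1 ⊗ₜ[k] chiMap Sinv α.toLinearMap x) * t) * y := by
      intro x y t
      induction t with
      | zero => simp
      | add p q hp hq => simp only [mul_add, add_mul, map_add, hp, hq]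
      | tmul p q => simp [lap, rap, hα x q]
    let D : H ⊗[k] H →ₗ[k] H := (TensorProduct.rid k H).toLinearMap ∘ₗ
      TensorProduct.map 𝐒 (lam ∘ₗ LinearMap.mulRight k h)
    have hD : ∀ x, rap lam ((1 ⊗ₜ[k] x) * comul (R := k) h) = D (comul (R := k) x) :=
      fun x ↦ rap_one_tmul_mul_comul lam hl x h
    have h1 := congrArg (LinearMap.mul' k H ∘ₗ LinearMap.rTensor H (D ∘ₗ comul)) hχ
    have h2 := congrArg (LinearMap.mul' k H ∘ₗ TensorProduct.map D (𝐒 ∘ₗ 𝐒)) hΔ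
    simp only [map_sum, LinearMap.comp_apply, LinearMap.rTensor_tmul, LinearMap.mul'_apply,
      TensorProduct.map_tmul] at h1 h2
    conv_lhs => rw [hs]
    simp only [Finset.mul_sum, map_sum, hmul, hD]
    rw [h1]
    simp only [← mul_assoc]
    rw [← Finset.sum_mul, h2]
    congr 1
    have hu' : 𝐒 (uElt R) = ∑ i ∈ s, 𝐒 i.1 * 𝐒 (𝐒 i.2) := by
      simp [uElt, hs, antipode_mul_antidistrib]
    have h3 := congrArg 𝐒 (congrArg 𝐒 hε')
    simp only [map_sum, map_smul, antipode_one] at h3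
    rw [hu']
    conv_rhs => rw [← mul_one (∑ i ∈ s, 𝐒 i.1 * 𝐒 (𝐒 i.2)), ← h3]
    rw [Finset.sum_mul_sum]
    refine Finset.sum_congr rfl fun i _ ↦ Finset.sum_congr rfl fun j hj ↦ ?_
    simp [D, hh j hj, antipode_mul_antidistrib, mul_assoc]
  rw [← hlhs, hcomm, hrhs]

section Inverse

variable {R U : H ⊗[k] H}

theorem antipode_rTensor_eq_inverse (hRU : R * U = 1)
    (hqt1 : (Coalgebra.comul (R := k)).rTensor H R =
      (((Algebra.TensorProduct.includeLeft : H →ₐ[k] (H ⊗[k] H))).toLinearMap.rTensor H R) *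
      (((Algebra.TensorProduct.includeRight : H →ₐ[k] (H ⊗[k] H))).toLinearMap.rTensor H R))
    (hε : lap (counit (R := k)) R = 1) : LinearMap.rTensor H 𝐒 R = U := by
  suffices LinearMap.rTensor H 𝐒 R * R = 1 from left_inv_eq_right_inv this hRU
  obtain ⟨s, hs⟩ := TensorProduct.exists_finset R
  have h := congrArg (LinearMap.rTensor H (LinearMap.mul' k H ∘ₗ LinearMap.rTensor H 𝐒))
    (sum_comul_tmul hs hqt1)
  simp only [map_sum, LinearMap.comp_apply, LinearMap.rTensor_tmul, LinearMap.mul'_apply,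
    mul_antipode_rTensor_comul_apply] at h
  have hε' : ∑ i ∈ s, counit (R := k) i.1 • i.2 = 1 := by
    simpa [lap, hs] using hε
  calc LinearMap.rTensor H 𝐒 R * R
      = ∑ i ∈ s, algebraMap k H (counit i.1) ⊗ₜ[k] i.2 := by simp [h, hs, Finset.sum_mul_sum]
    _ = 1 ⊗ₜ[k] ∑ i ∈ s, counit (R := k) i.1 • i.2 := by
      simp [TensorProduct.tmul_sum, Algebra.algebraMap_eq_smul_one, TensorProduct.smul_tmul]
    _ = 1 := by rw [hε', Algebra.TensorProduct.one_def]

theorem lTensor_comul_inverse (hRU : R * U = 1) (hUR : U * R = 1)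
    (hqt2 : (Coalgebra.comul (R := k)).lTensor H R =
      (LinearMap.lTensor H ((Algebra.TensorProduct.includeRight : H →ₐ[k] (H ⊗[k] H))).toLinearMap R) *
      (LinearMap.lTensor H ((Algebra.TensorProduct.includeLeft : H →ₐ[k] (H ⊗[k] H))).toLinearMap R)) :
    (Coalgebra.comul (R := k)).lTensor H U =
      (LinearMap.lTensor H ((Algebra.TensorProduct.includeLeft : H →ₐ[k] (H ⊗[k] H))).toLinearMap U) *
      (LinearMap.lTensor H ((Algebra.TensorProduct.includeRight : H →ₐ[k] (H ⊗[k] H))).toLinearMap U) := by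
  have hmul : ∀ (f : H →ₐ[k] (H ⊗[k] H)) (s t : H ⊗[k] H),
      LinearMap.lTensor H f.toLinearMap (s * t) =
        LinearMap.lTensor H f.toLinearMap s * LinearMap.lTensor H f.toLinearMap t :=
    fun f ↦ map_mul (Algebra.TensorProduct.map (AlgHom.id k H) f)
  have hone : ∀ f : H →ₐ[k] (H ⊗[k] H), LinearMap.lTensor H f.toLinearMap (1 : H ⊗[k] H) = 1 :=
    fun f ↦ map_one (Algebra.TensorProduct.map (AlgHom.id k H) f)
  have hcomul : Coalgebra.comul (R := k) (A := H) = (Bialgebra.comulAlgHom k H).toLinearMap := rfl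
  rw [hcomul] at hqt2 ⊢
  refine left_inv_eq_right_inv (a := LinearMap.lTensor H (Bialgebra.comulAlgHom k H).toLinearMap R)
    (by rw [← hmul, hUR, hone]) ?_
  rw [hqt2, mul_assoc, ← mul_assoc (LinearMap.lTensor H _ R) (LinearMap.lTensor H _ U),
    ← hmul, hRU, hone, one_mul, ← hmul, hRU, hone]

theorem antipode_lTensor_inverse (hRU : R * U = 1)
    (hU : (Coalgebra.comul (R := k)).lTensor H U =
      (LinearMap.lTensor H ((Algebra.TensorProduct.includeLeft : H →ₐ[k] (H ⊗[k] H))).toLinearMap U) *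
      (LinearMap.lTensor H ((Algebra.TensorProduct.includeRight : H →ₐ[k] (H ⊗[k] H))).toLinearMap U))
    (hε : rap (counit (R := k)) U = 1) : LinearMap.lTensor H 𝐒 U = R := by
  suffices U * LinearMap.lTensor H 𝐒 U = 1 from (left_inv_eq_right_inv hRU this).symm
  obtain ⟨s, hs⟩ := TensorProduct.exists_finset U
  have h := congrArg (LinearMap.lTensor H (LinearMap.mul' k H ∘ₗ LinearMap.lTensor H 𝐒)) hU
  simp [hs, Finset.sum_mul_sum] at h
  have hε' : ∑ i ∈ s, counit (R := k) i.2 • i.1 = 1 := by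
    simpa [rap, hs] using hε
  calc U * LinearMap.lTensor H 𝐒 U
      = ∑ i ∈ s, i.1 ⊗ₜ[k] algebraMap k H (counit i.2) := by simp [h, hs, Finset.sum_mul_sum]
    _ = (∑ i ∈ s, counit (R := k) i.2 • i.1) ⊗ₜ[k] 1 := by
      simp [TensorProduct.sum_tmul, Algebra.algebraMap_eq_smul_one, TensorProduct.smul_tmul]
    _ = 1 := by rw [hε', Algebra.TensorProduct.one_def]

end Inverse

theorem mul_eq_mul_of_inverse {x y z : H} (h : x * y = y * x) (hr : y * z = 1)
    (hl : z * y = 1) : x * z = z * x :=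
  (((Commute.units_inv_right (u := ⟨y, z, hr, hl⟩) h) : Commute x z)).eq

/-- In a co-Frobenius quasitriangular Hopf algebra,
$uv = vu = a·b_α = a·a_α$ for $u = S(R^2)R^1$ and $v = S(u)^{-1}$. -/
theorem uv_eq_a_mul_b_alpha
    (lam : H →ₗ[k] k) (hlam_ne : lam ≠ 0)
    (hlam_int : ∀ f : H →ₗ[k] k, conv f lam = f 1 • lam)
    (a : H) (ha_ne : a ≠ 0) (ha_grp : Coalgebra.comul (R := k) a = a ⊗ₜ[k] a)
    (ha_mod : ∀ h : H, lT lam h = lam h • (𝐒 a))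
    (ha_S2 : ∀ h : H, lam (𝐒 (𝐒 h)) = lam (a * h * 𝐒 a))
    (Sinv : H →ₗ[k] H) (hSinv_l : ∀ h : H, Sinv (𝐒 h) = h)
    (hSinv_r : ∀ h : H, 𝐒 (Sinv h) = h)
    (α : H →ₐ[k] k)
    (hα : ∀ h l : H, lam (l * h) = lam ((chiMap Sinv α.toLinearMap h) * l))
    (R U : H ⊗[k] H) (hRU : R * U = 1) (hUR : U * R = 1)
    (hqt4 : ∀ h : H, (TensorProduct.comm k H H) (Coalgebra.comul (R := k) h) =
      R * (Coalgebra.comul (R := k) h) * U)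
    (hqt1 : (Coalgebra.comul (R := k)).rTensor H R =
      (((Algebra.TensorProduct.includeLeft : H →ₐ[k] (H ⊗[k] H))).toLinearMap.rTensor H R) *
      (((Algebra.TensorProduct.includeRight : H →ₐ[k] (H ⊗[k] H))).toLinearMap.rTensor H R))
    (hqt2 : (Coalgebra.comul (R := k)).lTensor H R =
      (LinearMap.lTensor H ((Algebra.TensorProduct.includeRight : H →ₐ[k] (H ⊗[k] H))).toLinearMap R) *
      (LinearMap.lTensor H ((Algebra.TensorProduct.includeLeft : H →ₐ[k] (H ⊗[k] H))).toLinearMap R))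
    (hqt3l : lap (Coalgebra.counit (R := k)) R = 1)
    (hqt3r : rap (Coalgebra.counit (R := k)) R = 1)
    (u' : H) (hu_r : uElt R * u' = 1) (hu_l : u' * uElt R = 1)
    (hS2u : ∀ h : H, 𝐒 (𝐒 h) = uElt R * h * u')
    (hΔu : Coalgebra.comul (R := k) (uElt R) =
      ((uElt R) ⊗ₜ[k] (uElt R)) * (U * ((TensorProduct.comm k H H) U)))
    (v : H) (hv_r : 𝐒 (uElt R) * v = 1) (hv_l : v * 𝐒 (uElt R) = 1)
    (hdense : ∀ (f : H →ₗ[k] k) (s : Finset H), ∃ h : H, ∀ x ∈ s, lam (x * h) = f x) :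
    uElt R * v = v * uElt R ∧
      uElt R * v = a * rap (α.toLinearMap ∘ₗ Sinv) R ∧
      uElt R * v = a * lap α.toLinearMap R := by
  have hl := rap_comul_eq_of_conv_eq lam hlam_int
  have hUS := antipode_rTensor_eq_inverse hRU hqt1 hqt3l
  have hΔU := lTensor_comul_inverse hRU hUR hqt2
  have hεmul : ∀ s t : H ⊗[k] H,
      rap (counit (R := k)) (s * t) = rap (counit (R := k)) s * rap (counit (R := k)) t :=
    fun s t ↦ map_mul ((Algebra.TensorProduct.rid k k H).toAlgHom.comp
      (Algebra.TensorProduct.map (AlgHom.id k H) (Bialgebra.counitAlgHom k H))) s t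
  have hεU : rap (counit (R := k)) U = 1 := by
    have h1 := hεmul R U
    rw [hRU, hqt3r, one_mul] at h1
    simpa [rap, Algebra.TensorProduct.one_def] using h1.symm
  have hRS := antipode_lTensor_inverse hRU hΔU hεU
  have hSSR : TensorProduct.map 𝐒 𝐒 R = R := by
    rw [← LinearMap.lTensor_comp_rTensor, LinearMap.comp_apply, hUS, hRS]
  have hSSU : TensorProduct.map 𝐒 𝐒 U = U := by
    rw [← LinearMap.rTensor_comp_lTensor, LinearMap.comp_apply, hRS, hUS]
  obtain ⟨s, hs⟩ := TensorProduct.exists_finset R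
  obtain ⟨t, ht⟩ := TensorProduct.exists_finset U
  set u := uElt R with hu
  have hSu : 𝐒 (𝐒 u) = u := by rw [hS2u, mul_assoc, hu_r, mul_one]
  have key := uElt_mul_eq_antipode_uElt_mul_lap lam (𝐒 a) ha_mod hl Sinv hSinv_l hSinv_r α hα
    hdense R (fun h ↦ by rw [hqt4, mul_assoc, hUR, mul_one]) hqt1 hqt3l hSSR
  have hcm : ∀ p q : H ⊗[k] H, TensorProduct.comm k H H (p * q) =
      TensorProduct.comm k H H p * TensorProduct.comm k H H q :=
    map_mul (Algebra.TensorProduct.comm k H H)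
  have hcommU : ∀ h : H, TensorProduct.comm k H H U * comul (R := k) h =
      TensorProduct.comm k H H (comul (R := k) h) * TensorProduct.comm k H H U := by
    intro h
    have h1 : U * TensorProduct.comm k H H (comul (R := k) h) = comul (R := k) h * U := by
      rw [hqt4, ← mul_assoc, ← mul_assoc, hUR, one_mul]
    rw [← hcm, ← h1, hcm, TensorProduct.comm_comm]
  have hqtU : (Coalgebra.comul (R := k)).rTensor H (TensorProduct.comm k H H U) =
      (((Algebra.TensorProduct.includeLeft : H →ₐ[k] (H ⊗[k] H))).toLinearMap.rTensor H
        (TensorProduct.comm k H H U)) *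
      (((Algebra.TensorProduct.includeRight : H →ₐ[k] (H ⊗[k] H))).toLinearMap.rTensor H
        (TensorProduct.comm k H H U)) := by
    have h := congrArg (TensorProduct.comm k H (H ⊗[k] H)) hΔU
    simpa [ht, Finset.sum_mul_sum] using h
  have key' := uElt_mul_eq_antipode_uElt_mul_lap lam (𝐒 a) ha_mod hl Sinv hSinv_l hSinv_r α hα
    hdense (TensorProduct.comm k H H U) hcommU hqtU (by simpa [lap, rap, ht] using hεU)
    (by conv_rhs => rw [← hSSU]
        simp [ht])
  have huv : uElt (TensorProduct.comm k H H U) = v := by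
    have h1 : u * ∑ i ∈ t, Sinv i.2 * i.1 = 1 := by
      have h2 : uElt (R * U) = (1 : H) := by
        simp [uElt, hRU, Algebra.TensorProduct.one_def]
      have h3 : ∀ x, u * Sinv x = 𝐒 x * u := fun x ↦ by
        have h4 := hS2u (Sinv x)
        rw [hSinv_r] at h4
        rw [h4, mul_assoc, hu_l, mul_one]
      rw [← h2]
      simp only [Finset.mul_sum, ← mul_assoc, h3]
      rw [hu, hs, ht]
      simp [uElt, Finset.sum_mul, Finset.mul_sum, antipode_mul_antidistrib, mul_assoc]
    have h2 := congrArg 𝐒 h1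
    rw [antipode_mul_antidistrib, antipode_one] at h2
    refine left_inv_eq_right_inv ?_ hv_r
    rw [← h2, ht]
    simp [uElt, antipode_mul_antidistrib, hSinv_r]
  have hSv : 𝐒 v = u' := by
    have h1 := congrArg 𝐒 hv_r
    rw [antipode_mul_antidistrib, hSu, antipode_one] at h1
    exact left_inv_eq_right_inv h1 hu_r
  have hb : lap α.toLinearMap (TensorProduct.comm k H H U) = rap (α.toLinearMap ∘ₗ Sinv) R := by
    rw [← hRS]
    simp [lap, rap, ht, hSinv_l]
  have hga : IsGroupLikeElem k a := by
    refine ⟨?_, ha_grp⟩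
    have h1 := rTensor_counit_comul (R := k) a
    rw [ha_grp, LinearMap.rTensor_tmul] at h1
    have h2 := congrArg (TensorProduct.lid k H) h1
    simp only [TensorProduct.lid_tmul] at h2
    exact smul_left_injective k ha_ne h2
  have ha1 : a * 𝐒 a = 1 := hga.mul_antipode_cancel
  have ha2 : 𝐒 a * a = 1 := hga.antipode_mul_cancel
  rw [huv, hSv, hb] at key'
  have hau : a * u = u * a := by
    have h1 := hS2u a
    rw [hga.antipode_antipode] at h1
    conv_lhs => rw [h1]
    rw [mul_assoc, hu_l, mul_one]
  have haSu : a * 𝐒 u = 𝐒 u * a := by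
    have h1 := mul_eq_mul_of_inverse hau.symm ha1 ha2
    have h2 := congrArg 𝐒 h1
    rwa [antipode_mul_antidistrib, antipode_mul_antidistrib, hga.antipode_antipode] at h2
  have huSu : u * 𝐒 u = 𝐒 u * u := by
    have h1 := hS2u (𝐒 u)
    rw [hSu] at h1
    conv_rhs => rw [h1]
    rw [mul_assoc, hu_l, mul_one]
  have hav : a * v = v * a := mul_eq_mul_of_inverse haSu hv_r hv_l
  have huv' : u * v = v * u := mul_eq_mul_of_inverse huSu hv_r hv_l
  have hcancel : a * (u * v * 𝐒 a) = u * v := by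
    rw [← mul_assoc, ← mul_assoc, hau, mul_assoc u, hav, mul_assoc, mul_assoc, ha1, mul_one]
  refine ⟨huv', ?_, ?_⟩
  · have h1 : rap (α.toLinearMap ∘ₗ Sinv) R = u * v * 𝐒 a := by
      rw [mul_assoc, key', ← mul_assoc, hu_r, one_mul]
    rw [h1, hcancel]
  · have h1 : lap α.toLinearMap R = u * v * 𝐒 a := by
      rw [huv', mul_assoc, key, ← mul_assoc, hv_l, one_mul]
    rw [h1, hcancel]
end
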